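/- arXiv:1507.07056 — 3 statements merged into one kernel-verified Lean document; each statement's English description precedes it below -/
import Mathlib

section
/- Let N_R ≥ N_T ≥ 1 be natural numbers and let H be an N_R × N_T complex matrix with first column h₁ and remaining columns forming the N_R × (N_T − 1) matrix H₂. Assume that HᴴH and H₂ᴴH₂ are invertible, and set Q₂ = I − H₂(H₂ᴴH₂)⁻¹H₂ᴴ. Then the (1,1) entry of (HᴴH)⁻¹ satisfies [(HᴴH)⁻¹]₁,₁ · (h₁ᴴ Q₂ h₁) = 1; equivalently, 1/[(HᴴH)⁻¹]₁,₁ = h₁ᴴ Q₂ h₁. -/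
open Matrix

/-- Hermitian-form representation of the zero-forcing SNR for Stream 1:
`[(HᴴH)⁻¹]₁,₁ · (h₁ᴴ Q₂ h₁) = 1`. -/
theorem stmt0 (nR nT : ℕ) (hle : nT + 1 ≤ nR)
    (H : Matrix (Fin nR) (Fin (nT + 1)) ℂ)
    (h₁ : Fin nR → ℂ) (hh₁ : ∀ i, h₁ i = H i 0)
    (H₂ : Matrix (Fin nR) (Fin nT) ℂ) (hH₂ : ∀ i j, H₂ i j = H i j.succ)
    (hH : IsUnit (Hᴴ * H).det) (hH2 : IsUnit (H₂ᴴ * H₂).det)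
    (Q₂ : Matrix (Fin nR) (Fin nR) ℂ)
    (hQ₂ : Q₂ = 1 - H₂ * (H₂ᴴ * H₂)⁻¹ * H₂ᴴ) :
    ((Hᴴ * H)⁻¹ 0 0) * (star h₁ ⬝ᵥ Q₂ *ᵥ h₁) = 1 := by
  have hQ0 : H₂ᴴ * Q₂ = 0 := by
    rw [hQ₂, Matrix.mul_sub, Matrix.mul_one, ← Matrix.mul_assoc, ← Matrix.mul_assoc,
      Matrix.mul_nonsing_inv _ hH2, Matrix.one_mul, sub_self]
  set w : Fin nT → ℂ := ((H₂ᴴ * H₂)⁻¹ * H₂ᴴ) *ᵥ h₁ with hw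
  set v : Fin (nT + 1) → ℂ := Fin.cons 1 (-w) with hv
  set s : ℂ := star h₁ ⬝ᵥ Q₂ *ᵥ h₁ with hs
  have hHv : H *ᵥ v = Q₂ *ᵥ h₁ := by
    have h1 : H *ᵥ v = h₁ - H₂ *ᵥ w := by
      ext i
      simp [Matrix.mulVec, dotProduct, Fin.sum_univ_succ, hv, hh₁, hH₂, sub_eq_add_neg]
    rw [h1, hQ₂, hw, Matrix.sub_mulVec, Matrix.one_mulVec, Matrix.mulVec_mulVec,
      Matrix.mul_assoc]
  have hG : (Hᴴ * H) *ᵥ v = Pi.single 0 s := by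
    rw [← Matrix.mulVec_mulVec, hHv]
    ext j
    refine Fin.cases ?_ (fun k => ?_) j
    · rw [Pi.single_eq_same, hs]
      simp [Matrix.mulVec, dotProduct, hh₁]
    · rw [Pi.single_eq_of_ne (Fin.succ_ne_zero k)]
      have h2 : (H₂ᴴ *ᵥ (Q₂ *ᵥ h₁)) k = 0 := by
        rw [Matrix.mulVec_mulVec, hQ0, Matrix.zero_mulVec, Pi.zero_apply]
      rw [← h2]
      simp [Matrix.mulVec, dotProduct, hH₂]
  have h3 : v = (Hᴴ * H)⁻¹ *ᵥ Pi.single 0 s := by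
    rw [← hG, Matrix.mulVec_mulVec, Matrix.nonsing_inv_mul _ hH, Matrix.one_mulVec]
  have h4 := congrFun h3 0
  rw [Matrix.mulVec, dotProduct_single] at h4
  rw [← h4, hv, Fin.cons_zero]
end

section
/- Let R be an N_I × N_I Hermitian positive definite complex matrix, let b̃ be a nonzero vector in ℂ^{N_I}, let Ṽ be an N_I × N_I unitary matrix whose first column equals b̃/‖b̃‖, and let A be an upper triangular N_I × N_I complex matrix with real positive diagonal entries such that AAᴴ = ṼᴴRṼ (the Cholesky decomposition). Then b̃ᴴR⁻¹b̃ = ‖b̃‖²/([A]₁,₁)², where [A]₁,₁ is the (real positive) first diagonal entry of A. -/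
open Matrix ComplexOrder

/-- Cholesky expression for the noncentrality parameter: if `R` is Hermitian positive
definite, `Ṽ` is unitary with first column `b̃/‖b̃‖`, and `AAᴴ = ṼᴴRṼ` with `A` upper
triangular having real positive diagonal, then `b̃ᴴR⁻¹b̃ = ‖b̃‖²/([A]₁,₁)²`. -/
theorem stmt7 (m : ℕ)
    (R : Matrix (Fin (m + 1)) (Fin (m + 1)) ℂ) (hR : R.PosDef)
    (b : Fin (m + 1) → ℂ) (hb : b ≠ 0)
    (nb : ℝ) (hnb : nb = Real.sqrt (∑ i, Complex.normSq (b i)))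
    (V : Matrix (Fin (m + 1)) (Fin (m + 1)) ℂ)
    (hV : V ∈ Matrix.unitaryGroup (Fin (m + 1)) ℂ)
    (hVcol : ∀ i, V i 0 = b i / (nb : ℂ))
    (A : Matrix (Fin (m + 1)) (Fin (m + 1)) ℂ)
    (hAtri : ∀ i j : Fin (m + 1), j < i → A i j = 0)
    (hAdiag : ∀ i, 0 < (A i i).re ∧ (A i i).im = 0)
    (hchol : A * Aᴴ = Vᴴ * R * V) :
    star b ⬝ᵥ R⁻¹ *ᵥ b = ((nb : ℂ)) ^ 2 / (A 0 0) ^ 2 := by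
  have hnb0 : (nb : ℂ) ≠ 0 := by
    have hpos : 0 < ∑ i, Complex.normSq (b i) := by
      obtain ⟨i, hi⟩ := Function.ne_iff.mp hb
      exact Finset.sum_pos' (fun j _ => Complex.normSq_nonneg _)
        ⟨i, Finset.mem_univ _, Complex.normSq_pos.mpr hi⟩
    have : 0 < nb := hnb ▸ Real.sqrt_pos.mpr hpos
    exact_mod_cast this.ne'
  have ha0 : A 0 0 ≠ 0 := by
    intro h
    have := (hAdiag 0).1
    simp [h] at this
  have hastar : star (A 0 0) = A 0 0 := Complex.conj_eq_iff_im.mpr (hAdiag 0).2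
  have hV1 : Vᴴ * V = 1 := Matrix.mem_unitaryGroup_iff'.mp hV
  have hV2 : V * Vᴴ = 1 := Matrix.mem_unitaryGroup_iff.mp hV
  have hRu : IsUnit R.det := (Matrix.isUnit_iff_isUnit_det _).mp hR.isUnit
  have hAu : IsUnit Aᴴ.det := by
    have hd : A.det ≠ 0 := by
      rw [Matrix.det_of_upperTriangular (fun i j h => hAtri i j h)]
      refine Finset.prod_ne_zero_iff.mpr fun i _ h => ?_
      have := (hAdiag i).1
      simp [h] at this
    rw [Matrix.det_conjTranspose]
    exact isUnit_iff_ne_zero.mpr (star_ne_zero.mpr hd)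
  have hbV : b = (nb : ℂ) • (V *ᵥ Pi.single 0 1) := by
    ext i
    simp [hVcol, mul_div_cancel₀ _ hnb0]
  have hAe : A *ᵥ Pi.single 0 1 = A 0 0 • Pi.single 0 1 := by
    ext i
    by_cases hi : i = 0
    · subst hi; simp
    · simp [hi, hAtri i 0 (Fin.pos_of_ne_zero hi)]
  obtain ⟨y, hy⟩ : ∃ y, Aᴴ *ᵥ y = Pi.single 0 1 :=
    ⟨Aᴴ⁻¹ *ᵥ Pi.single 0 1, by rw [Matrix.mulVec_mulVec, Matrix.mul_nonsing_inv _ hAu,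
      Matrix.one_mulVec]⟩
  have hy0 : A 0 0 * y 0 = 1 := by
    have h := congrFun hy 0
    simp only [Matrix.mulVec, dotProduct, Matrix.conjTranspose_apply, Pi.single_eq_same] at h
    rw [Finset.sum_eq_single 0] at h
    · rwa [hastar] at h
    · intro j _ hj
      simp [hAtri j 0 (Fin.pos_of_ne_zero hj)]
    · simp
  have hRV : R * V = V * (A * Aᴴ) := by
    rw [hchol, ← Matrix.mul_assoc, ← Matrix.mul_assoc, hV2, Matrix.one_mul]
  have hRx : R *ᵥ (((nb : ℂ) / A 0 0) • (V *ᵥ y)) = b := by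
    rw [Matrix.mulVec_smul, Matrix.mulVec_mulVec, hRV, ← Matrix.mulVec_mulVec,
      ← Matrix.mulVec_mulVec, hy, hAe, Matrix.mulVec_smul, smul_smul,
      div_mul_cancel₀ _ ha0, ← hbV]
  have hx : R⁻¹ *ᵥ b = ((nb : ℂ) / A 0 0) • (V *ᵥ y) := by
    rw [← hRx, Matrix.mulVec_mulVec, Matrix.nonsing_inv_mul _ hRu, Matrix.one_mulVec]
  have hbx : star b ⬝ᵥ (V *ᵥ y) = nb * y 0 := by
    rw [hbV, star_smul, Matrix.star_mulVec, smul_dotProduct, ← Matrix.dotProduct_mulVec,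
      Matrix.mulVec_mulVec, hV1, Matrix.one_mulVec]
    simp [dotProduct, Pi.single_apply, apply_ite]
  rw [hx, dotProduct_smul, hbx, smul_eq_mul, eq_div_of_mul_eq ha0 ((mul_comm _ _).trans hy0)]
  field_simp
end

section
/- Let N and N_R be natural numbers with 1 ≤ N ≤ N_R, let H : ℕ → ℂ be a bounded sequence, and let c₁ and z be complex numbers. Then the doubly indexed family (n₁,n₂) ↦ e^{−z} · ((N)_{n₁}/((N_R+n₂)_{n₁})) · (c₁z)^{n₁}/n₁! · z^{n₂}/n₂! · H_{n₁} is absolutely summable, and its sum equals the single series e^{−z} Σ_{n=0}^{∞} G_n zⁿ/n!, where G_n = Σ_{m=0}^{n} C(n,m) · ((N)_m/((N_R+n−m)_m)) · H_m · c₁^m and C(n,m) is the binomial coefficient. -/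
theorem aux_diag (f : ℕ × ℕ → ℂ) (hf : Summable f) :
    ∑' p, f p = ∑' n, ∑ p ∈ Finset.HasAntidiagonal.antidiagonal n, f p := by
  have h := (Equiv.summable_iff (Finset.HasAntidiagonal.sigmaAntidiagonalEquivProd (A := ℕ))).2 hf
  rw [← (Finset.HasAntidiagonal.sigmaAntidiagonalEquivProd (A := ℕ)).tsum_eq f]
  refine (h.tsum_sigma' (fun n => (hasSum_fintype _).summable)).trans ?_
  congr 1
  ext n
  rw [tsum_fintype]
  exact Finset.sum_coe_sort (Finset.HasAntidiagonal.antidiagonal n) f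

theorem aux_asc_mono (a b : ℕ) (h : a ≤ b) (m : ℕ) : a.ascFactorial m ≤ b.ascFactorial m := by
  induction m with
  | zero => simp
  | succ k ih =>
    rw [Nat.ascFactorial_succ, Nat.ascFactorial_succ]
    exact Nat.mul_le_mul (by omega) ih

theorem aux_asc_cast (a m : ℕ) :
    (ascPochhammer ℂ m).eval (a : ℂ) = ((a.ascFactorial m : ℕ) : ℂ) := by
  rw [← ascPochhammer_nat_eq_ascFactorial, ascPochhammer_eval_cast]

theorem aux_ratio (a b : ℕ) (h : a ≤ b) (m : ℕ) :
    ‖(ascPochhammer ℂ m).eval (a : ℂ) / (ascPochhammer ℂ m).eval (b : ℂ)‖ ≤ 1 := by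
  rw [aux_asc_cast, aux_asc_cast, norm_div, Complex.norm_natCast, Complex.norm_natCast]
  exact div_le_one_of_le₀ (by exact_mod_cast aux_asc_mono a b h m) (by positivity)

/-- Lemma 3 of the paper: with `x₂ = z`, `x₁ = c₁z`, the generic double infinite
series is absolutely summable and equals the single series
`e^{−z} Σₙ Gₙ zⁿ/n!` with `Gₙ = Σ_{m=0}^{n} C(n,m)·(N)_m/((N_R+n−m)_m)·H_m·c₁^m`. -/
theorem stmt15 (N NR : ℕ) (hN : 1 ≤ N) (hNNR : N ≤ NR)
    (H : ℕ → ℂ) (C : ℝ) (hH : ∀ n, ‖H n‖ ≤ C)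
    (c₁ z : ℂ)
    (G : ℕ → ℂ)
    (hG : ∀ n, G n = ∑ m ∈ Finset.range (n + 1),
        (n.choose m : ℂ) * ((ascPochhammer ℂ m).eval (N : ℂ) /
          (ascPochhammer ℂ m).eval (((NR + (n - m) : ℕ)) : ℂ)) * H m * c₁ ^ m) :
    Summable (fun p : ℕ × ℕ => ‖Complex.exp (-z) *
        ((ascPochhammer ℂ p.1).eval (N : ℂ) /
          (ascPochhammer ℂ p.1).eval ((NR : ℂ) + (p.2 : ℂ))) *
        ((c₁ * z) ^ p.1 / (p.1.factorial : ℂ)) * (z ^ p.2 / (p.2.factorial : ℂ)) *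
        H p.1‖) ∧
    (∑' p : ℕ × ℕ, Complex.exp (-z) *
        ((ascPochhammer ℂ p.1).eval (N : ℂ) /
          (ascPochhammer ℂ p.1).eval ((NR : ℂ) + (p.2 : ℂ))) *
        ((c₁ * z) ^ p.1 / (p.1.factorial : ℂ)) * (z ^ p.2 / (p.2.factorial : ℂ)) *
        H p.1) =
      Complex.exp (-z) * ∑' n : ℕ, G n * z ^ n / (n.factorial : ℂ) := by
  have hsum : Summable (fun p : ℕ × ℕ => ‖Complex.exp (-z) *
        ((ascPochhammer ℂ p.1).eval (N : ℂ) /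
          (ascPochhammer ℂ p.1).eval ((NR : ℂ) + (p.2 : ℂ))) *
        ((c₁ * z) ^ p.1 / (p.1.factorial : ℂ)) * (z ^ p.2 / (p.2.factorial : ℂ)) *
        H p.1‖) := by
    have hb : Summable (fun p : ℕ × ℕ => ‖Complex.exp (-z)‖ * C *
        ((‖c₁ * z‖ ^ p.1 / (p.1.factorial : ℝ)) * (‖z‖ ^ p.2 / (p.2.factorial : ℝ)))) := by
      apply Summable.mul_left
      exact Summable.mul_of_nonneg (Real.summable_pow_div_factorial ‖c₁ * z‖)
        (Real.summable_pow_div_factorial ‖z‖)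
        (fun n => by positivity) (fun n => by positivity)
    refine Summable.of_nonneg_of_le (fun p => norm_nonneg _) (fun p => ?_) hb
    have h1 := aux_ratio N (NR + p.2) (by omega) p.1
    push_cast at h1
    have h2 := hH p.1
    rw [norm_mul, norm_mul, norm_mul, norm_mul, norm_div (_ ^ _), norm_div (_ ^ _), norm_pow,
      norm_pow, Complex.norm_natCast, Complex.norm_natCast]
    calc _ ≤ ‖Complex.exp (-z)‖ * 1 * (‖c₁ * z‖ ^ p.1 / (p.1.factorial : ℝ)) *
          (‖z‖ ^ p.2 / (p.2.factorial : ℝ)) * C := by gcongr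
      _ = _ := by ring
  refine ⟨hsum, ?_⟩
  have hs := hsum.of_norm
  rw [← tsum_mul_left, aux_diag _ hs]
  congr 1
  ext n
  rw [hG n, mul_div_assoc, Finset.sum_mul, Finset.mul_sum,
    Finset.Nat.sum_antidiagonal_eq_sum_range_succ_mk]
  refine Finset.sum_congr rfl (fun m hm => ?_)
  have hmn : m ≤ n := by simpa [Nat.lt_succ_iff] using hm
  rw [Nat.cast_choose ℂ hmn, mul_pow, Nat.cast_add NR (n - m)]
  have hz : z ^ n = z ^ m * z ^ (n - m) := by rw [← pow_add, Nat.add_sub_cancel' hmn]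
  have f1 : (n.factorial : ℂ) ≠ 0 := by exact_mod_cast n.factorial_ne_zero
  have f2 : (m.factorial : ℂ) ≠ 0 := by exact_mod_cast m.factorial_ne_zero
  have f3 : ((n - m).factorial : ℂ) ≠ 0 := by exact_mod_cast (n - m).factorial_ne_zero
  rw [hz]
  generalize (ascPochhammer ℂ m).eval (N : ℂ) /
    (ascPochhammer ℂ m).eval ((NR : ℂ) + ((n - m : ℕ) : ℂ)) = r
  field_simp
end
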